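/- There exists C > 0 depending only on λ₀, M₀, α₊, α₋ and β such that if τ ≤ m₊(ξ,0)/((1−κ)α₊), 0 < s ≤ s₀ ≤ 1/C, and τ ≥ C, then: (i) Λ|ω₊(ξ,0)|² + Λ²∫₀^∞|ω₊(ξ,y)|² dy + ∫₀^∞|∂_y ω₊(ξ,y)|² dy ≤ C‖E₊ω₊(ξ,·)‖²_{L²(ℝ₊)}; and (ii) if moreover supp v̂₋(ξ,·) ⊂ [−α₋/(2β), 0], then Λ²∫_{−∞}^0 |v̂₋(ξ,y)|² dy + ∫_{−∞}^0 |∂_y v̂₋(ξ,y)|² dy ≤ C‖E₋v̂₋(ξ,·)‖²_{L²(ℝ₋)} + CΛ|v̂₋(ξ,0)|². -/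

import Mathlib

open MeasureTheory

noncomputable section

/-- `ℝ^m`, the tangential space (here `m = n - 1`). -/
abbrev Em (m : ℕ) : Type := EuclideanSpace ℝ (Fin m)

variable {m : ℕ}

/-- The entry `a_{nn}(y)` of the coefficient matrix. -/
def ann (a : ℝ → Matrix (Fin (m + 1)) (Fin (m + 1)) ℝ) (y : ℝ) : ℝ :=
  a y (Fin.last m) (Fin.last m)

/-- `b_{jk}(y) = a_{jk}(y) - a_{nj}(y) a_{nk}(y) / a_{nn}(y)`. -/
def bcoef (a : ℝ → Matrix (Fin (m + 1)) (Fin (m + 1)) ℝ) (j k : Fin m) (y : ℝ) : ℝ :=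
  a y j.castSucc k.castSucc -
    a y (Fin.last m) j.castSucc * a y (Fin.last m) k.castSucc / ann a y

/-- The quadratic form `B(ξ, η, y) = Σ_{jk} b_{jk}(y) ξ_j η_k`. -/
def Bform (a : ℝ → Matrix (Fin (m + 1)) (Fin (m + 1)) ℝ) (ξ η : Em m) (y : ℝ) : ℝ :=
  ∑ j, ∑ k, bcoef a j k y * ξ j * η k

/-- `t(ξ, y) = Σ_j a_{nj}(y) ξ_j / a_{nn}(y)`. -/
def tform (a : ℝ → Matrix (Fin (m + 1)) (Fin (m + 1)) ℝ) (ξ : Em m) (y : ℝ) : ℝ :=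
  (∑ j, a y (Fin.last m) j.castSucc * ξ j) / ann a y

/-- `m(ξ, y) = (B(ξ,ξ,y)/a_{nn}(y))^{1/2}`. -/
def mfun (a : ℝ → Matrix (Fin (m + 1)) (Fin (m + 1)) ℝ) (ξ : Em m) (y : ℝ) : ℝ :=
  Real.sqrt (Bform a ξ ξ y / ann a y)

/-- `t(ξ + iτsγ, y)`, the ℂ-linear extension of `t` evaluated at `ξ + iτsγ`. -/
def tC (a : ℝ → Matrix (Fin (m + 1)) (Fin (m + 1)) ℝ) (ξ γ : Em m) (τ s y : ℝ) : ℂ :=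
  (tform a ξ y : ℂ) + Complex.I * ((τ * s : ℝ) : ℂ) * (tform a γ y : ℂ)

/-- `ζ(ξ,y) = a_{nn}(y)⁻¹ [B(ξ,ξ,y) + 2isτ B(ξ,γ,y) - s²τ² B(γ,γ,y)]`. -/
def zetafun (a : ℝ → Matrix (Fin (m + 1)) (Fin (m + 1)) ℝ) (ξ γ : Em m) (τ s y : ℝ) : ℂ :=
  ((ann a y : ℝ) : ℂ)⁻¹ *
    ((Bform a ξ ξ y : ℂ) + 2 * Complex.I * ((s * τ : ℝ) : ℂ) * (Bform a ξ γ y : ℂ) -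
      ((s * τ : ℝ) : ℂ) ^ 2 * (Bform a γ γ y : ℂ))

/-- The principal square root `√ζ`. -/
def sqz (a : ℝ → Matrix (Fin (m + 1)) (Fin (m + 1)) ℝ) (ξ γ : Em m) (τ s y : ℝ) : ℂ :=
  zetafun a ξ γ τ s y ^ ((1 : ℂ) / 2)

/-- The first-order factor `E v = ∂_y v + i t(ξ+iτsγ,y) v - (τφ' + √ζ) v`. -/
def Eop (a : ℝ → Matrix (Fin (m + 1)) (Fin (m + 1)) ℝ) (ξ γ : Em m) (τ s α β : ℝ)
    (v : ℝ → ℂ) (y : ℝ) : ℂ :=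
  deriv v y +
    (Complex.I * tC a ξ γ τ s y - (((τ * (α + β * y) : ℝ) : ℂ) + sqz a ξ γ τ s y)) * v y

/-- The first-order factor `F v = ∂_y v + i t(ξ+iτsγ,y) v - (τφ' - √ζ) v`. -/
def Fop (a : ℝ → Matrix (Fin (m + 1)) (Fin (m + 1)) ℝ) (ξ γ : Em m) (τ s α β : ℝ)
    (v : ℝ → ℂ) (y : ℝ) : ℂ :=
  deriv v y +
    (Complex.I * tC a ξ γ τ s y - (((τ * (α + β * y) : ℝ) : ℂ) - sqz a ξ γ τ s y)) * v y

/-- `a_{nn}(y) (∂_y - τφ' + i t(ξ+iτsγ,y)) v`. -/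
def Pinner (a : ℝ → Matrix (Fin (m + 1)) (Fin (m + 1)) ℝ) (ξ γ : Em m) (τ s α β : ℝ)
    (v : ℝ → ℂ) (y : ℝ) : ℂ :=
  (ann a y : ℂ) * (deriv v y + (Complex.I * tC a ξ γ τ s y - ((τ * (α + β * y) : ℝ) : ℂ)) * v y)

/-- The conjugated operator
`P v = (∂_y - τφ' + i t(ξ+iτsγ,y)) [a_{nn} (∂_y - τφ' + i t(ξ+iτsγ,y)) v] - a_{nn} ζ v`. -/
def Pop (a : ℝ → Matrix (Fin (m + 1)) (Fin (m + 1)) ℝ) (ξ γ : Em m) (τ s α β : ℝ)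
    (v : ℝ → ℂ) (y : ℝ) : ℂ :=
  deriv (Pinner a ξ γ τ s α β v) y +
    (Complex.I * tC a ξ γ τ s y - ((τ * (α + β * y) : ℝ) : ℂ)) * Pinner a ξ γ τ s α β v y -
    (ann a y : ℂ) * zetafun a ξ γ τ s y * v y

/-- `V(ξ) = a_{nn}(0) [∂_y v(0) - τα v(0) + i t(ξ+iτsγ,0) v(0)]`. -/
def Vval (a : ℝ → Matrix (Fin (m + 1)) (Fin (m + 1)) ℝ) (ξ γ : Em m) (τ s α : ℝ)
    (v : ℝ → ℂ) : ℂ :=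
  (ann a 0 : ℂ) * (deriv v 0 - ((τ * α : ℝ) : ℂ) * v 0 + Complex.I * tC a ξ γ τ s 0 * v 0)

/-- `ω₊ = a_{nn} F v`. -/
def omegaP (a : ℝ → Matrix (Fin (m + 1)) (Fin (m + 1)) ℝ) (ξ γ : Em m) (τ s α β : ℝ)
    (v : ℝ → ℂ) (y : ℝ) : ℂ :=
  (ann a y : ℂ) * Fop a ξ γ τ s α β v y

/-- `ω₋ = a_{nn} E v`. -/
def omegaM (a : ℝ → Matrix (Fin (m + 1)) (Fin (m + 1)) ℝ) (ξ γ : Em m) (τ s α β : ℝ)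
    (v : ℝ → ℂ) (y : ℝ) : ℂ :=
  (ann a y : ℂ) * Eop a ξ γ τ s α β v y

/-- Squared `L²` norm on `(0, ∞)`. -/
def L2p (v : ℝ → ℂ) : ℝ := ∫ y in Set.Ioi (0 : ℝ), ‖v y‖ ^ 2

/-- Squared `L²` norm on `(-∞, 0)`. -/
def L2m (v : ℝ → ℂ) : ℝ := ∫ y in Set.Iio (0 : ℝ), ‖v y‖ ^ 2

/-- `Λ = (|ξ|² + τ²)^{1/2}`. -/
def Lam (ξ : Em m) (τ : ℝ) : ℝ := Real.sqrt (‖ξ‖ ^ 2 + τ ^ 2)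

/-- `L = sup_{ξ ≠ 0} m₊(ξ,0)/m₋(ξ,0)`. -/
def Lconst (ap am : ℝ → Matrix (Fin (m + 1)) (Fin (m + 1)) ℝ) : ℝ :=
  ⨆ ξ : {ξ : Em m // ξ ≠ 0}, mfun ap ξ.1 0 / mfun am ξ.1 0

/-- `κ = (1 - L α₋/α₊)/2`. -/
def kappa (ap am : ℝ → Matrix (Fin (m + 1)) (Fin (m + 1)) ℝ) (αp αm : ℝ) : ℝ :=
  (1 - Lconst ap am * (αm / αp)) / 2

/-- The coefficient matrix `A(y)` is symmetric, uniformly elliptic with constant `λ₀`,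
and Lipschitz with constant `M₀`. -/
def GoodCoeff (lam0 M0 : ℝ) (a : ℝ → Matrix (Fin (m + 1)) (Fin (m + 1)) ℝ) : Prop :=
  (∀ y, (a y).IsSymm) ∧
  (∀ (y : ℝ) (z : EuclideanSpace ℝ (Fin (m + 1))),
      lam0 * ‖z‖ ^ 2 ≤ ∑ i, ∑ j, a y i j * z i * z j ∧
      ∑ i, ∑ j, a y i j * z i * z j ≤ lam0⁻¹ * ‖z‖ ^ 2) ∧
  (∀ y y' i j, |a y i j - a y' i j| ≤ M0 * |y - y'|)

/-- The ellipticity bounds `λ₁|ξ|² ≤ B(ξ,ξ,y) ≤ λ₁⁻¹|ξ|²`. -/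
def GoodB (lam1 : ℝ) (a : ℝ → Matrix (Fin (m + 1)) (Fin (m + 1)) ℝ) : Prop :=
  ∀ (ξ : Em m) (y : ℝ), lam1 * ‖ξ‖ ^ 2 ≤ Bform a ξ ξ y ∧ Bform a ξ ξ y ≤ lam1⁻¹ * ‖ξ‖ ^ 2


section LocallyLipschitz

theorem LocallyLipschitz.contDiffAt_comp {E F : Type*} [NormedAddCommGroup E] [NormedSpace ℝ E]
    [NormedAddCommGroup F] [NormedSpace ℝ F] {Φ : E → F} {f : ℝ → E} (hf : LocallyLipschitz f)
    (hΦ : ∀ x, ContDiffAt ℝ 1 Φ (f x)) : LocallyLipschitz (fun x => Φ (f x)) := by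
  intro x
  obtain ⟨K, t, ht, hK⟩ := hf x
  obtain ⟨K', t', ht', hK'⟩ := (hΦ x).exists_lipschitzOnWith
  refine ⟨K' * K, t ∩ f ⁻¹' t', Filter.inter_mem ht (hf.continuous.continuousAt ht'), ?_⟩
  exact hK'.comp (hK.mono Set.inter_subset_left) fun y hy => hy.2

theorem LocallyLipschitz.fun_add' {E : Type*} [NormedAddCommGroup E] [NormedSpace ℝ E]
    {f g : ℝ → E} (hf : LocallyLipschitz f) (hg : LocallyLipschitz g) :
    LocallyLipschitz (fun x => f x + g x) :=
  (hf.prodMk hg).contDiffAt_comp (Φ := fun p : E × E => p.1 + p.2) fun _ => by fun_prop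

theorem LocallyLipschitz.fun_sub' {E : Type*} [NormedAddCommGroup E] [NormedSpace ℝ E]
    {f g : ℝ → E} (hf : LocallyLipschitz f) (hg : LocallyLipschitz g) :
    LocallyLipschitz (fun x => f x - g x) :=
  (hf.prodMk hg).contDiffAt_comp (Φ := fun p : E × E => p.1 - p.2) fun _ => by fun_prop

theorem LocallyLipschitz.fun_mul' {A : Type*} [NormedRing A] [NormedAlgebra ℝ A]
    {f g : ℝ → A} (hf : LocallyLipschitz f) (hg : LocallyLipschitz g) :
    LocallyLipschitz (fun x => f x * g x) :=
  (hf.prodMk hg).contDiffAt_comp (Φ := fun p : A × A => p.1 * p.2) fun _ => by fun_prop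

theorem LocallyLipschitz.fun_inv' {A : Type*} [NormedField A] [NormedAlgebra ℝ A]
    {f : ℝ → A} (hf : LocallyLipschitz f) (h0 : ∀ x, f x ≠ 0) :
    LocallyLipschitz (fun x => (f x)⁻¹) :=
  hf.contDiffAt_comp (Φ := fun z => z⁻¹) fun x => contDiffAt_inv ℝ (h0 x)

theorem LocallyLipschitz.fun_div' {A : Type*} [NormedField A] [NormedAlgebra ℝ A]
    {f g : ℝ → A} (hf : LocallyLipschitz f) (hg : LocallyLipschitz g) (h0 : ∀ x, g x ≠ 0) :
    LocallyLipschitz (fun x => f x / g x) := by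
  simpa only [div_eq_mul_inv] using hf.fun_mul' (hg.fun_inv' h0)

theorem LocallyLipschitz.fun_sum' {ι E : Type*} [NormedAddCommGroup E] [NormedSpace ℝ E]
    {f : ι → ℝ → E} (s : Finset ι) (hf : ∀ i, LocallyLipschitz (f i)) :
    LocallyLipschitz (fun x => ∑ i ∈ s, f i x) := by
  classical
  induction s using Finset.induction_on with
  | empty => simpa using LocallyLipschitz.const (0 : E)
  | insert i s hi ih =>
    simp only [Finset.sum_insert hi]
    exact (hf i).fun_add' ih

theorem LocallyLipschitz.ofReal {f : ℝ → ℝ} (hf : LocallyLipschitz f) :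
    LocallyLipschitz (fun x => (f x : ℂ)) :=
  Complex.isometry_ofReal.lipschitz.locallyLipschitz.comp hf

theorem LocallyLipschitz.norm_sq {f : ℝ → ℂ} (hf : LocallyLipschitz f) :
    LocallyLipschitz (fun x => ‖f x‖ ^ 2) :=
  hf.contDiffAt_comp (Φ := fun z : ℂ => ‖z‖ ^ 2) fun _ => (contDiff_norm_sq ℝ).contDiffAt

theorem LocallyLipschitz.exists_lipschitzOnWith_Icc {E : Type*} [PseudoMetricSpace E]
    {f : ℝ → E} (hf : LocallyLipschitz f) (a b : ℝ) :
    ∃ K, LipschitzOnWith K f (Set.Icc a b) :=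
  hf.locallyLipschitzOn.exists_lipschitzOnWith_of_compact isCompact_Icc

theorem LocallyLipschitz.ae_differentiableAt {f : ℝ → ℂ} (hf : LocallyLipschitz f) :
    ∀ᵐ x, DifferentiableAt ℝ f x := by
  refine LocallyBoundedVariationOn.ae_differentiableAt fun a b _ _ => ?_
  rcases le_or_gt a b with hab | hab
  · obtain ⟨K, hK⟩ := hf.exists_lipschitzOnWith_Icc a b
    have := hK.locallyBoundedVariationOn a b (by simp [hab]) (by simp [hab])
    simpa using this
  · rw [Set.Icc_eq_empty hab.not_ge, Set.inter_empty]
    simp [BoundedVariationOn]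

theorem LocallyLipschitz.exists_norm_deriv_le {f : ℝ → ℂ} (hf : LocallyLipschitz f) (a b : ℝ) :
    ∃ K : ℝ, ∀ x ∈ Set.Icc a b, ‖deriv f x‖ ≤ K := by
  obtain ⟨K, hK⟩ := hf.exists_lipschitzOnWith_Icc (a - 1) (b + 1)
  refine ⟨K, fun x hx => norm_deriv_le_of_lipschitzOn (s := Set.Icc (a - 1) (b + 1)) ?_ hK⟩
  exact Icc_mem_nhds (by linarith [hx.1]) (by linarith [hx.2])

theorem LocallyLipschitz.absolutelyContinuousOnInterval {f : ℝ → ℝ} (hf : LocallyLipschitz f)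
    (a b : ℝ) : AbsolutelyContinuousOnInterval f a b := by
  obtain ⟨K, hK⟩ := hf.exists_lipschitzOnWith_Icc (min a b) (max a b)
  exact hK.absolutelyContinuousOnInterval

theorem intervalIntegrable_of_norm_le {h : ℝ → ℝ} (hm : Measurable h) {a b K : ℝ} (hab : a ≤ b)
    (hK : ∀ x ∈ Set.Icc a b, ‖h x‖ ≤ K) : IntervalIntegrable h volume a b := by
  rw [intervalIntegrable_iff_integrableOn_Icc_of_le hab]
  refine Measure.integrableOn_of_bounded (M := K) (by simp) hm.aestronglyMeasurable ?_
  exact (ae_restrict_iff' measurableSet_Icc).2 (Filter.Eventually.of_forall hK)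

theorem LocallyLipschitz.intervalIntegrable_norm_deriv_add_sq {f q : ℝ → ℂ}
    (hf : LocallyLipschitz f) (hq : Continuous q) {a b : ℝ} (hab : a ≤ b) :
    IntervalIntegrable (fun y => ‖deriv f y + q y * f y‖ ^ 2) volume a b := by
  obtain ⟨K, hK⟩ := hf.exists_norm_deriv_le a b
  obtain ⟨K', hK'⟩ := isCompact_Icc.exists_bound_of_continuousOn
    (s := Set.Icc a b) (hq.mul hf.continuous).continuousOn
  refine intervalIntegrable_of_norm_le (K := (K + K') ^ 2) ?_ hab fun x hx => ?_
  · exact (((measurable_deriv f).add (hq.mul hf.continuous).measurable).norm).pow_const 2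
  · rw [Real.norm_of_nonneg (by positivity)]
    gcongr
    exact (norm_add_le _ _).trans (add_le_add (hK x hx) (hK' x hx))

end LocallyLipschitz

section Energy

/-- The pointwise form of the weighted energy estimate for `∂_y + q`. -/
theorem weighted_energy_pointwise {f f' q : ℂ} {w k c : ℝ} (hc : 0 < c) (hk : 0 ≤ k) (hw : 0 ≤ w)
    (hq : f ≠ 0 → c * w ≤ -q.re) :
    c ^ 2 * (w ^ 2 * ‖f‖ ^ 2) ≤
      c * (k * ‖f‖ ^ 2 + w * (2 * inner ℝ f f')) + ‖f' + q * f‖ ^ 2 := by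
  rcases eq_or_ne f 0 with rfl | hf
  · simp
  have h := hq hf
  have e1 : inner ℝ f f' = f.re * f'.re + f.im * f'.im := by
    rw [Complex.inner]
    simp [mul_comm]
  rw [e1, ← Complex.normSq_eq_norm_sq, ← Complex.normSq_eq_norm_sq, Complex.normSq_apply,
    Complex.normSq_apply]
  simp only [Complex.add_re, Complex.add_im, Complex.mul_re, Complex.mul_im]
  have h1 : 0 ≤ c * w * (f.re * f.re + f.im * f.im) * (-q.re - c * w) := by
    have : 0 ≤ -q.re - c * w := by linarith
    have := add_nonneg (mul_self_nonneg f.re) (mul_self_nonneg f.im)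
    positivity
  have h2 : 0 ≤ c * k * (f.re * f.re + f.im * f.im) := by
    have := add_nonneg (mul_self_nonneg f.re) (mul_self_nonneg f.im)
    positivity
  nlinarith [sq_nonneg (c * w * f.re + (f'.re + (q.re * f.re - q.im * f.im))),
    sq_nonneg (c * w * f.im + (f'.im + (q.re * f.im + q.im * f.re)))]

theorem deriv_norm_sq_le {f f' q : ℂ} {w D : ℝ} (hq : f ≠ 0 → ‖q‖ ≤ D * w) :
    ‖f'‖ ^ 2 ≤ 2 * ‖f' + q * f‖ ^ 2 + 2 * D ^ 2 * (w ^ 2 * ‖f‖ ^ 2) := by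
  have h1 : ‖f'‖ ≤ ‖f' + q * f‖ + ‖q * f‖ := by
    simpa using norm_sub_le (f' + q * f) (q * f)
  have h2 : ‖q * f‖ ≤ D * w * ‖f‖ := by
    rcases eq_or_ne f 0 with rfl | hf
    · simp
    · rw [norm_mul]
      exact mul_le_mul_of_nonneg_right (hq hf) (norm_nonneg _)
  have h3 : ‖f'‖ ^ 2 ≤ (‖f' + q * f‖ + D * w * ‖f‖) ^ 2 := by
    gcongr
    linarith
  nlinarith [sq_nonneg (‖f' + q * f‖ - D * w * ‖f‖)]

variable {f q : ℝ → ℂ} {Λ k c D a b : ℝ}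

theorem LocallyLipschitz.weighted_energy_le (hf : LocallyLipschitz f) (hq : Continuous q)
    (hab : a ≤ b) (hk : 0 ≤ k) (hc : 0 < c) (hw : ∀ y ∈ Set.Ioo a b, 0 ≤ Λ + k * y)
    (hre : ∀ y ∈ Set.Ioo a b, f y ≠ 0 → c * (Λ + k * y) ≤ -(q y).re) :
    c ^ 2 * (∫ y in a..b, (Λ + k * y) ^ 2 * ‖f y‖ ^ 2) ≤
      c * ((Λ + k * b) * ‖f b‖ ^ 2 - (Λ + k * a) * ‖f a‖ ^ 2) +
        ∫ y in a..b, ‖deriv f y + q y * f y‖ ^ 2 := by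
  set h : ℝ → ℝ := fun y => (Λ + k * y) * ‖f y‖ ^ 2 with hdef
  have hwl : LocallyLipschitz (fun y : ℝ => Λ + k * y) :=
    ContDiff.locallyLipschitz (𝕂 := ℝ) (by fun_prop)
  have hac : AbsolutelyContinuousOnInterval h a b :=
    (hwl.fun_mul' hf.norm_sq).absolutelyContinuousOnInterval a b
  have hg := hf.intervalIntegrable_norm_deriv_add_sq hq hab
  have hfc := hf.continuous
  rw [← hac.integral_deriv_eq_sub, ← intervalIntegral.integral_const_mul,
    ← intervalIntegral.integral_const_mul, ← intervalIntegral.integral_add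
      (hac.intervalIntegrable_deriv.const_mul c) hg]
  refine intervalIntegral.integral_mono_ae_restrict hab
    (Continuous.intervalIntegrable (by fun_prop) a b)
    ((hac.intervalIntegrable_deriv.const_mul c).add hg) ?_
  rw [← restrict_Ioo_eq_restrict_Icc]
  refine (ae_restrict_iff' measurableSet_Ioo).2 ?_
  filter_upwards [hf.ae_differentiableAt] with y hy hyab
  have hd : HasDerivAt h (k * ‖f y‖ ^ 2 + (Λ + k * y) * (2 * inner ℝ (f y) (deriv f y))) y := by
    have h1 : HasDerivAt (fun y : ℝ => Λ + k * y) k y := by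
      simpa using ((hasDerivAt_id y).const_mul k).const_add Λ
    exact h1.mul hy.hasDerivAt.norm_sq
  rw [hd.deriv]
  exact weighted_energy_pointwise hc hk (hw y hyab) (hre y hyab)

theorem LocallyLipschitz.integral_norm_deriv_sq_le (hf : LocallyLipschitz f) (hq : Continuous q)
    (hab : a ≤ b) (hD : ∀ y ∈ Set.Ioo a b, f y ≠ 0 → ‖q y‖ ≤ D * (Λ + k * y)) :
    ∫ y in a..b, ‖deriv f y‖ ^ 2 ≤ 2 * (∫ y in a..b, ‖deriv f y + q y * f y‖ ^ 2) +
      2 * D ^ 2 * ∫ y in a..b, (Λ + k * y) ^ 2 * ‖f y‖ ^ 2 := by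
  have hg := hf.intervalIntegrable_norm_deriv_add_sq hq hab
  have hd : IntervalIntegrable (fun y => ‖deriv f y‖ ^ 2) volume a b := by
    simpa using hf.intervalIntegrable_norm_deriv_add_sq (q := 0) continuous_zero hab
  have hfc := hf.continuous
  have hw : IntervalIntegrable (fun y => (Λ + k * y) ^ 2 * ‖f y‖ ^ 2) volume a b :=
    Continuous.intervalIntegrable (by fun_prop) a b
  rw [← intervalIntegral.integral_const_mul, ← intervalIntegral.integral_const_mul,
    ← intervalIntegral.integral_add (hg.const_mul 2) (hw.const_mul _)]
  refine intervalIntegral.integral_mono_on_of_le_Ioo hab hd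
    ((hg.const_mul 2).add (hw.const_mul _)) fun y hy => ?_
  exact deriv_norm_sq_le (hD y hy)

theorem HasCompactSupport.exists_deriv_eq_zero (hf : HasCompactSupport f) :
    ∃ R > 0, ∀ y, R ≤ |y| → f y = 0 ∧ deriv f y = 0 := by
  obtain ⟨R, hR⟩ := (Metric.isBounded_iff_subset_closedBall 0).1
    (hf.isCompact.isBounded.union hf.deriv.isCompact.isBounded)
  refine ⟨max R 0 + 1, by positivity, fun y hy => ?_⟩
  have hy' : y ∉ tsupport f ∪ tsupport (deriv f) := fun h => by
    have := hR h
    rw [mem_closedBall_zero_iff, Real.norm_eq_abs] at this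
    linarith [le_max_left R 0]
  rw [Set.mem_union, not_or] at hy'
  exact ⟨image_eq_zero_of_notMem_tsupport hy'.1, image_eq_zero_of_notMem_tsupport hy'.2⟩

theorem L2p_eq_intervalIntegral {R : ℝ} (hR : 0 < R) (h : ∀ y, R ≤ |y| → f y = 0) :
    L2p f = ∫ y in (0 : ℝ)..R, ‖f y‖ ^ 2 := by
  rw [L2p, intervalIntegral.integral_of_le hR.le]
  refine setIntegral_eq_of_subset_of_forall_sdiff_eq_zero measurableSet_Ioi
    (fun y hy => hy.1) fun y hy => ?_
  have : R ≤ |y| := by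
    have h1 : 0 < y := hy.1
    have h2 : ¬ (0 < y ∧ y ≤ R) := hy.2
    rw [abs_of_pos h1]
    grind
  simp [h y this]

theorem L2m_eq_intervalIntegral {R : ℝ} (hR : 0 < R) (h : ∀ y, R ≤ |y| → f y = 0) :
    L2m f = ∫ y in (-R)..0, ‖f y‖ ^ 2 := by
  rw [L2m, intervalIntegral.integral_of_le (by linarith), ← integral_Iic_eq_integral_Iio]
  refine setIntegral_eq_of_subset_of_forall_sdiff_eq_zero measurableSet_Iic
    (fun y hy => hy.2) fun y hy => ?_
  have : R ≤ |y| := by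
    have h1 : y ≤ 0 := hy.1
    have h2 : ¬ (-R < y ∧ y ≤ 0) := hy.2
    rw [abs_of_nonpos h1]
    grind
  simp [h y this]

theorem L2p_nonneg (f : ℝ → ℂ) : 0 ≤ L2p f :=
  integral_nonneg fun _ => by positivity

theorem L2m_nonneg (f : ℝ → ℂ) : 0 ≤ L2m f :=
  integral_nonneg fun _ => by positivity

/-- The constant in the energy estimates for `∂_y + q`. -/
def energyConst (c D : ℝ) : ℝ := 2 + (2 + 2 * D ^ 2) * (1 / c + 1 / c ^ 2)

theorem energyConst_pos (hc : 0 < c) : 0 < energyConst c D := by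
  unfold energyConst
  positivity

theorem LocallyLipschitz.energy_le_L2p (hf : LocallyLipschitz f) (hfs : HasCompactSupport f)
    (hq : Continuous q) (hΛ : 0 < Λ) (hk : 0 ≤ k) (hc : 0 < c)
    (hre : ∀ y, 0 < y → c * (Λ + k * y) ≤ -(q y).re)
    (hD : ∀ y, 0 < y → ‖q y‖ ≤ D * (Λ + k * y)) :
    Λ * ‖f 0‖ ^ 2 + Λ ^ 2 * L2p f + L2p (deriv f) ≤
      energyConst c D * L2p (fun y => deriv f y + q y * f y) := by
  obtain ⟨R, hR, hfR⟩ := hfs.exists_deriv_eq_zero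
  have h1 := hf.weighted_energy_le hq hR.le hk hc
    (fun y hy => by have := hy.1; positivity) (fun y hy _ => hre y hy.1)
  have h2 := hf.integral_norm_deriv_sq_le hq hR.le (fun y hy _ => hD y hy.1)
  have h3 : Λ ^ 2 * (∫ y in (0 : ℝ)..R, ‖f y‖ ^ 2) ≤
      ∫ y in (0 : ℝ)..R, (Λ + k * y) ^ 2 * ‖f y‖ ^ 2 := by
    have hfc := hf.continuous
    rw [← intervalIntegral.integral_const_mul]
    refine intervalIntegral.integral_mono_on hR.le
      (Continuous.intervalIntegrable (by fun_prop) _ _)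
      (Continuous.intervalIntegrable (by fun_prop) _ _) fun y hy => ?_
    have : 0 ≤ k * y := mul_nonneg hk hy.1
    gcongr
    linarith
  have hGeq := L2p_eq_intervalIntegral (f := fun y => deriv f y + q y * f y) hR
    fun y hy => by simp [hfR y hy]
  rw [← hGeq] at h1 h2
  rw [← L2p_eq_intervalIntegral hR fun y hy => (hfR y hy).1] at h3
  rw [← L2p_eq_intervalIntegral hR fun y hy => (hfR y hy).2] at h2
  rw [(hfR R (le_abs_self R)).1] at h1
  have hI : 0 ≤ ∫ y in (0 : ℝ)..R, (Λ + k * y) ^ 2 * ‖f y‖ ^ 2 :=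
    intervalIntegral.integral_nonneg hR.le fun _ _ => by positivity
  set I := ∫ y in (0 : ℝ)..R, (Λ + k * y) ^ 2 * ‖f y‖ ^ 2
  set G := L2p fun y => deriv f y + q y * f y
  have hG : 0 ≤ G := L2p_nonneg _
  simp only [norm_zero, mul_zero, add_zero] at h1
  norm_num at h1
  have hb : 0 ≤ Λ * ‖f 0‖ ^ 2 := by positivity
  have h4 : Λ * ‖f 0‖ ^ 2 ≤ 1 / c * G := by
    rw [div_mul_eq_mul_div, one_mul, le_div_iff₀ hc]
    nlinarith [mul_nonneg (sq_nonneg c) hI]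
  have h5 : I ≤ 1 / c ^ 2 * G := by
    rw [div_mul_eq_mul_div, one_mul, le_div_iff₀ (by positivity)]
    nlinarith [mul_nonneg hc.le hb]
  have h6 : (1 + 2 * D ^ 2) * I ≤ (1 + 2 * D ^ 2) * (1 / c ^ 2 * G) := by gcongr
  have h7 : 0 ≤ (1 + 2 * D ^ 2) * (1 / c * G) := by positivity
  have h8 : 0 ≤ 1 / c ^ 2 * G := by positivity
  unfold energyConst
  linarith

theorem LocallyLipschitz.energy_le_L2m (hf : LocallyLipschitz f) (hfs : HasCompactSupport f)
    (hq : Continuous q) (hΛ : 0 < Λ) (hc : 0 < c)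
    (hre : ∀ y < 0, f y ≠ 0 → c * Λ ≤ -(q y).re)
    (hD : ∀ y < 0, f y ≠ 0 → ‖q y‖ ≤ D * Λ) :
    Λ ^ 2 * L2m f + L2m (deriv f) ≤
      energyConst c D * L2m (fun y => deriv f y + q y * f y) +
        energyConst c D * Λ * ‖f 0‖ ^ 2 := by
  obtain ⟨R, hR, hfR⟩ := hfs.exists_deriv_eq_zero
  have hR' : -R ≤ 0 := by linarith
  have h1 := hf.weighted_energy_le (Λ := Λ) (k := 0) hq hR' le_rfl hc
    (fun y hy => by simpa using hΛ.le) (fun y hy h => by simpa using hre y hy.2 h)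
  have h2 := hf.integral_norm_deriv_sq_le (Λ := Λ) (k := 0) (D := D) hq hR'
    (fun y hy h => by simpa using hD y hy.2 h)
  simp only [zero_mul, add_zero, intervalIntegral.integral_const_mul] at h1 h2
  have hGeq := L2m_eq_intervalIntegral (f := fun y => deriv f y + q y * f y) hR
    fun y hy => by simp [hfR y hy]
  rw [← hGeq, ← L2m_eq_intervalIntegral hR fun y hy => (hfR y hy).1] at h1 h2
  rw [← L2m_eq_intervalIntegral hR fun y hy => (hfR y hy).2] at h2
  rw [(hfR (-R) (by rw [abs_neg]; exact le_abs_self R)).1] at h1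
  have hI : 0 ≤ Λ ^ 2 * L2m f := mul_nonneg (sq_nonneg _) (L2m_nonneg f)
  set I := Λ ^ 2 * L2m f
  set G := L2m fun y => deriv f y + q y * f y
  have hG : 0 ≤ G := L2m_nonneg _
  norm_num at h1
  have hb : 0 ≤ Λ * ‖f 0‖ ^ 2 := by positivity
  set B := Λ * ‖f 0‖ ^ 2
  have h5 : I ≤ 1 / c * B + 1 / c ^ 2 * G := by
    have : 1 / c * B + 1 / c ^ 2 * G = (c * B + G) / c ^ 2 := by field_simp
    rw [this, le_div_iff₀ (by positivity)]
    linarith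
  have h6 : (1 + 2 * D ^ 2) * I ≤ (1 + 2 * D ^ 2) * (1 / c * B + 1 / c ^ 2 * G) := by gcongr
  have h7 : 0 ≤ (2 + 2 * D ^ 2) * (1 / c * G) := by positivity
  have h8 : 0 ≤ 1 / c ^ 2 * G := by positivity
  have h9 : 0 ≤ (2 + 2 * D ^ 2) * (1 / c ^ 2 * B) := by positivity
  have h10 : 0 ≤ 1 / c * B := by positivity
  have : energyConst c D * Λ * ‖f 0‖ ^ 2 = energyConst c D * B := by ring
  rw [this]
  unfold energyConst
  linarith

end Energy

section Coefficients

variable {m : ℕ} {a : ℝ → Matrix (Fin (m + 1)) (Fin (m + 1)) ℝ} {lam0 M0 lam1 : ℝ}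

theorem GoodCoeff.locallyLipschitz_apply (h : GoodCoeff lam0 M0 a) (i j : Fin (m + 1)) :
    LocallyLipschitz fun y => a y i j := by
  refine (LipschitzWith.of_dist_le_mul (K := M0.toNNReal) fun y y' => ?_).locallyLipschitz
  rw [Real.dist_eq, Real.dist_eq, Real.coe_toNNReal']
  exact (h.2.2 y y' i j).trans (by gcongr; exact le_max_left _ _)

theorem GoodCoeff.ann_bounds (h : GoodCoeff lam0 M0 a) (y : ℝ) :
    lam0 ≤ ann a y ∧ ann a y ≤ lam0⁻¹ := by
  have := h.2.1 y (EuclideanSpace.single (Fin.last m) 1)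
  simpa [ann, PiLp.single_apply] using this

theorem GoodCoeff.quadratic_snoc_nonneg (h : GoodCoeff lam0 M0 a) (h0 : 0 ≤ lam0) (y r : ℝ)
    (γ : Em m) :
    0 ≤ (∑ i : Fin m, ∑ j : Fin m, a y i.castSucc j.castSucc * γ i * γ j) +
        2 * r * (∑ j : Fin m, a y (Fin.last m) j.castSucc * γ j) + r ^ 2 * ann a y := by
  have h1 := (h.2.1 y (WithLp.toLp 2 (Fin.snoc γ.ofLp r : Fin (m + 1) → ℝ))).1
  have h2 : ∀ j : Fin m, a y j.castSucc (Fin.last m) = a y (Fin.last m) j.castSucc :=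
    fun j => (h.1 y).apply _ _
  simp only [Fin.sum_univ_castSucc, Fin.snoc_castSucc, Fin.snoc_last, h2,
    Finset.sum_add_distrib] at h1
  have h3 : ∑ j : Fin m, a y (Fin.last m) j.castSucc * γ j * r =
      r * ∑ j : Fin m, a y (Fin.last m) j.castSucc * γ j := by
    rw [Finset.mul_sum]
    exact Finset.sum_congr rfl fun _ _ => by ring
  have h4 : ∑ j : Fin m, a y (Fin.last m) j.castSucc * r * γ j =
      r * ∑ j : Fin m, a y (Fin.last m) j.castSucc * γ j := by
    rw [Finset.mul_sum]
    exact Finset.sum_congr rfl fun _ _ => by ring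
  rw [h3, h4] at h1
  have := (mul_nonneg h0 (sq_nonneg _)).trans h1
  unfold ann
  linarith

theorem GoodCoeff.quadratic_le (h : GoodCoeff lam0 M0 a) (y : ℝ) (γ : Em m) :
    ∑ i : Fin m, ∑ j : Fin m, a y i.castSucc j.castSucc * γ i * γ j ≤ lam0⁻¹ * ‖γ‖ ^ 2 := by
  have h1 := (h.2.1 y (WithLp.toLp 2 (Fin.snoc γ.ofLp 0 : Fin (m + 1) → ℝ))).2
  simpa [EuclideanSpace.norm_sq_eq, Fin.sum_univ_castSucc] using h1

theorem GoodCoeff.abs_tform_le (h : GoodCoeff lam0 M0 a) (h0 : 0 < lam0) (y : ℝ) (γ : Em m) :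
    |tform a γ y| ≤ lam0⁻¹ ^ 2 * ‖γ‖ := by
  obtain ⟨hn1, hn2⟩ := h.ann_bounds y
  have hn : 0 < ann a y := h0.trans_le hn1
  set N := ∑ j : Fin m, a y (Fin.last m) j.castSucc * γ j with hN
  have hQ := h.quadratic_le y γ
  have hp := h.quadratic_snoc_nonneg h0.le y ‖γ‖ γ
  have hm := h.quadratic_snoc_nonneg h0.le y (-‖γ‖) γ
  have hNle : |N| ≤ lam0⁻¹ * ‖γ‖ := by
    rcases eq_or_ne γ 0 with rfl | hγ
    · simp [hN]
    · have hγ' : 0 < ‖γ‖ := norm_pos_iff.2 hγ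
      have hs : ‖γ‖ ^ 2 * ann a y ≤ ‖γ‖ ^ 2 * lam0⁻¹ := by gcongr
      rw [abs_le]
      constructor <;> refine le_of_mul_le_mul_left ?_ hγ' <;> nlinarith
  have h5 : (ann a y)⁻¹ ≤ lam0⁻¹ := by gcongr
  rw [tform, ← hN, abs_div, abs_of_pos hn, div_eq_mul_inv]
  calc |N| * (ann a y)⁻¹ ≤ (lam0⁻¹ * ‖γ‖) * lam0⁻¹ := by gcongr
    _ = lam0⁻¹ ^ 2 * ‖γ‖ := by ring

theorem GoodCoeff.Bform_comm (h : GoodCoeff lam0 M0 a) (y : ℝ) (ξ η : Em m) :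
    Bform a ξ η y = Bform a η ξ y := by
  unfold Bform
  rw [Finset.sum_comm]
  refine Finset.sum_congr rfl fun j _ => Finset.sum_congr rfl fun k _ => ?_
  have : bcoef a j k y = bcoef a k j y := by
    unfold bcoef
    rw [(h.1 y).apply j.castSucc k.castSucc]
    ring
  rw [this]
  ring

theorem GoodCoeff.Bform_add_smul (h : GoodCoeff lam0 M0 a) (y r : ℝ) (ξ η : Em m) :
    Bform a (ξ + r • η) (ξ + r • η) y =
      Bform a ξ ξ y + 2 * r * Bform a ξ η y + r ^ 2 * Bform a η η y := by
  have e : Bform a (ξ + r • η) (ξ + r • η) y =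
      Bform a ξ ξ y + r * Bform a ξ η y + r * Bform a η ξ y + r ^ 2 * Bform a η η y := by
    simp only [Bform, Finset.mul_sum, ← Finset.sum_add_distrib]
    refine Finset.sum_congr rfl fun j _ => Finset.sum_congr rfl fun k _ => ?_
    simp only [PiLp.add_apply, PiLp.smul_apply, smul_eq_mul]
    ring
  rw [e, h.Bform_comm y η ξ]
  ring

theorem GoodB.Bform_nonneg (hB : GoodB lam1 a) (h1 : 0 < lam1) (ξ : Em m) (y : ℝ) :
    0 ≤ Bform a ξ ξ y :=
  (by positivity : 0 ≤ lam1 * ‖ξ‖ ^ 2).trans (hB ξ y).1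

theorem zetafun_re (ξ γ : Em m) (τ s y : ℝ) :
    (zetafun a ξ γ τ s y).re =
      (Bform a ξ ξ y - (s * τ) ^ 2 * Bform a γ γ y) / ann a y := by
  rw [zetafun, ← Complex.ofReal_inv, Complex.re_ofReal_mul, div_eq_inv_mul]
  simp [← Complex.ofReal_pow, ← Complex.ofReal_mul]

theorem zetafun_im (ξ γ : Em m) (τ s y : ℝ) :
    (zetafun a ξ γ τ s y).im = 2 * (s * τ) * Bform a ξ γ y / ann a y := by
  rw [zetafun, ← Complex.ofReal_inv, Complex.im_ofReal_mul, div_eq_inv_mul]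
  simp [← Complex.ofReal_pow, ← Complex.ofReal_mul]

theorem GoodCoeff.norm_zetafun_le (h : GoodCoeff lam0 M0 a) (hB : GoodB lam1 a) (h0 : 0 < lam0)
    (h1 : 0 < lam1) (ξ γ : Em m) (τ s y : ℝ) :
    ‖zetafun a ξ γ τ s y‖ ≤
      2 * (lam0 * lam1)⁻¹ * (‖ξ‖ ^ 2 + (s * τ) ^ 2 * ‖γ‖ ^ 2) := by
  obtain ⟨hn1, -⟩ := h.ann_bounds y
  have hn : 0 < ann a y := h0.trans_le hn1
  have hξ := hB.Bform_nonneg h1 ξ y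
  have hγ := hB.Bform_nonneg h1 γ y
  have hp := h.Bform_add_smul y (s * τ) ξ γ ▸ hB.Bform_nonneg h1 (ξ + (s * τ) • γ) y
  have hm := h.Bform_add_smul y (-(s * τ)) ξ γ ▸ hB.Bform_nonneg h1 (ξ + (-(s * τ)) • γ) y
  have e1 : |(zetafun a ξ γ τ s y).re| ≤
      (Bform a ξ ξ y + (s * τ) ^ 2 * Bform a γ γ y) / ann a y := by
    rw [zetafun_re, abs_div, abs_of_pos hn]
    gcongr
    have := mul_nonneg (sq_nonneg (s * τ)) hγ
    rw [abs_le]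
    constructor <;> linarith
  have e2 : |(zetafun a ξ γ τ s y).im| ≤
      (Bform a ξ ξ y + (s * τ) ^ 2 * Bform a γ γ y) / ann a y := by
    rw [zetafun_im, abs_div, abs_of_pos hn]
    gcongr
    rw [abs_le]
    constructor <;> linarith
  have e3 : (Bform a ξ ξ y + (s * τ) ^ 2 * Bform a γ γ y) / ann a y ≤
      (lam1⁻¹ * ‖ξ‖ ^ 2 + (s * τ) ^ 2 * (lam1⁻¹ * ‖γ‖ ^ 2)) / lam0 := by
    have := (hB ξ y).2
    have := (hB γ y).2
    gcongr
  have e4 : (lam1⁻¹ * ‖ξ‖ ^ 2 + (s * τ) ^ 2 * (lam1⁻¹ * ‖γ‖ ^ 2)) / lam0 =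
      (lam0 * lam1)⁻¹ * (‖ξ‖ ^ 2 + (s * τ) ^ 2 * ‖γ‖ ^ 2) := by
    field_simp
  have := Complex.norm_le_abs_re_add_abs_im (zetafun a ξ γ τ s y)
  linarith

theorem GoodCoeff.le_zetafun_re (h : GoodCoeff lam0 M0 a) (hB : GoodB lam1 a) (h0 : 0 < lam0)
    (h1 : 0 < lam1) {ξ γ : Em m} (hγ : ‖γ‖ ≤ 1) {τ s : ℝ} (hs : 0 ≤ s) (hτ : 0 ≤ τ)
    (hsτ : s * τ ≤ lam1 / 2 * ‖ξ‖) (y : ℝ) :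
    lam0 * lam1 / 2 * ‖ξ‖ ^ 2 ≤ (zetafun a ξ γ τ s y).re := by
  obtain ⟨hn1, hn2⟩ := h.ann_bounds y
  have hn : 0 < ann a y := h0.trans_le hn1
  have hγB : (s * τ) ^ 2 * Bform a γ γ y ≤ (lam1 / 2 * ‖ξ‖) ^ 2 * lam1⁻¹ := by
    have h3 : Bform a γ γ y ≤ lam1⁻¹ := by
      refine (hB γ y).2.trans ?_
      have : ‖γ‖ ^ 2 ≤ 1 := pow_le_one₀ (norm_nonneg _) hγ
      nlinarith [inv_pos.2 h1]
    have := hB.Bform_nonneg h1 γ y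
    gcongr
  have e : (lam1 / 2 * ‖ξ‖) ^ 2 * lam1⁻¹ = lam1 / 4 * ‖ξ‖ ^ 2 := by
    field_simp
    ring
  have hnum : lam1 / 2 * ‖ξ‖ ^ 2 ≤ Bform a ξ ξ y - (s * τ) ^ 2 * Bform a γ γ y := by
    have := (hB ξ y).1
    have : 0 ≤ lam1 * ‖ξ‖ ^ 2 := by positivity
    linarith
  rw [zetafun_re, le_div_iff₀ hn]
  calc lam0 * lam1 / 2 * ‖ξ‖ ^ 2 * ann a y ≤ lam0 * lam1 / 2 * ‖ξ‖ ^ 2 * lam0⁻¹ := by gcongr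
    _ = lam1 / 2 * ‖ξ‖ ^ 2 := by field_simp
    _ ≤ _ := hnum

theorem Complex.cpow_half_sq (z : ℂ) : (z ^ ((1 : ℂ) / 2)) ^ 2 = z := by
  simp

theorem Complex.cpow_half_re_nonneg (z : ℂ) : 0 ≤ (z ^ ((1 : ℂ) / 2)).re := by
  rcases eq_or_ne z 0 with rfl | hz
  · simp
  rw [Complex.cpow_def_of_ne_zero hz, Complex.exp_re]
  refine mul_nonneg (Real.exp_pos _).le (Real.cos_nonneg_of_mem_Icc ?_)
  have him : (Complex.log z * (1 / 2)).im = z.arg / 2 := by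
    simp [Complex.mul_im, Complex.log_im, div_eq_mul_inv]
  rw [him]
  constructor <;> linarith [Complex.neg_pi_lt_arg z, Complex.arg_le_pi z]

theorem Complex.le_cpow_half_re {z : ℂ} {r : ℝ} (h : r ^ 2 ≤ z.re) :
    r ≤ (z ^ ((1 : ℂ) / 2)).re := by
  refine le_of_sq_le_sq ?_ (Complex.cpow_half_re_nonneg z)
  have := congrArg Complex.re (Complex.cpow_half_sq z)
  rw [sq, Complex.mul_re] at this
  nlinarith [mul_self_nonneg (z ^ ((1 : ℂ) / 2)).im]

end Coefficients

section Operators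

variable {m : ℕ} {a : ℝ → Matrix (Fin (m + 1)) (Fin (m + 1)) ℝ} {lam0 M0 lam1 : ℝ}
  {ξ γ : Em m} {τ s α β : ℝ}

theorem GoodCoeff.ann_ne_zero (h : GoodCoeff lam0 M0 a) (h0 : 0 < lam0) (y : ℝ) :
    ann a y ≠ 0 :=
  (h0.trans_le (h.ann_bounds y).1).ne'

theorem GoodCoeff.locallyLipschitz_ann (h : GoodCoeff lam0 M0 a) : LocallyLipschitz (ann a) :=
  h.locallyLipschitz_apply _ _

theorem GoodCoeff.locallyLipschitz_tform (h : GoodCoeff lam0 M0 a) (h0 : 0 < lam0) (ξ : Em m) :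
    LocallyLipschitz (tform a ξ) :=
  (LocallyLipschitz.fun_sum' _ fun _ =>
    (h.locallyLipschitz_apply _ _).fun_mul' (.const _)).fun_div' h.locallyLipschitz_ann
      (h.ann_ne_zero h0)

theorem GoodCoeff.locallyLipschitz_Bform (h : GoodCoeff lam0 M0 a) (h0 : 0 < lam0)
    (ξ η : Em m) : LocallyLipschitz (Bform a ξ η) := by
  refine LocallyLipschitz.fun_sum' _ fun j => LocallyLipschitz.fun_sum' _ fun k => ?_
  refine LocallyLipschitz.fun_mul' (LocallyLipschitz.fun_mul' ?_ (.const _)) (.const _)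
  exact (h.locallyLipschitz_apply _ _).fun_sub'
    (((h.locallyLipschitz_apply _ _).fun_mul' (h.locallyLipschitz_apply _ _)).fun_div'
      h.locallyLipschitz_ann (h.ann_ne_zero h0))

theorem GoodCoeff.locallyLipschitz_tC (h : GoodCoeff lam0 M0 a) (h0 : 0 < lam0) :
    LocallyLipschitz (tC a ξ γ τ s) :=
  (h.locallyLipschitz_tform h0 ξ).ofReal.fun_add'
    (LocallyLipschitz.fun_mul' (.const _) (h.locallyLipschitz_tform h0 γ).ofReal)

theorem GoodCoeff.locallyLipschitz_zetafun (h : GoodCoeff lam0 M0 a) (h0 : 0 < lam0) :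
    LocallyLipschitz (zetafun a ξ γ τ s) := by
  refine LocallyLipschitz.fun_mul' (h.locallyLipschitz_ann.ofReal.fun_inv' fun y => ?_) ?_
  · exact Complex.ofReal_ne_zero.2 (h.ann_ne_zero h0 y)
  · exact ((h.locallyLipschitz_Bform h0 ξ ξ).ofReal.fun_add'
      (LocallyLipschitz.fun_mul' (.const _) (h.locallyLipschitz_Bform h0 ξ γ).ofReal)).fun_sub'
      (LocallyLipschitz.fun_mul' (.const _) (h.locallyLipschitz_Bform h0 γ γ).ofReal)

theorem GoodCoeff.locallyLipschitz_sqz (h : GoodCoeff lam0 M0 a) (h0 : 0 < lam0)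
    (hre : ∀ y, 0 < (zetafun a ξ γ τ s y).re) : LocallyLipschitz (sqz a ξ γ τ s) := by
  refine (h.locallyLipschitz_zetafun h0).contDiffAt_comp
    (Φ := fun z : ℂ => z ^ ((1 : ℂ) / 2)) fun y => ?_
  exact (analyticAt_id.cpow analyticAt_const (Or.inl (hre y))).contDiffAt.restrict_scalars ℝ

/-- The zeroth-order coefficient of `Eop`. -/
def Ecoef (a : ℝ → Matrix (Fin (m + 1)) (Fin (m + 1)) ℝ) (ξ γ : Em m) (τ s α β y : ℝ) : ℂ :=
  Complex.I * tC a ξ γ τ s y - (((τ * (α + β * y) : ℝ) : ℂ) + sqz a ξ γ τ s y)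

/-- The zeroth-order coefficient of `Fop`. -/
def Fcoef (a : ℝ → Matrix (Fin (m + 1)) (Fin (m + 1)) ℝ) (ξ γ : Em m) (τ s α β y : ℝ) : ℂ :=
  Complex.I * tC a ξ γ τ s y - (((τ * (α + β * y) : ℝ) : ℂ) - sqz a ξ γ τ s y)

theorem locallyLipschitz_weight :
    LocallyLipschitz fun y : ℝ => (((τ * (α + β * y) : ℝ)) : ℂ) :=
  LocallyLipschitz.ofReal (ContDiff.locallyLipschitz (𝕂 := ℝ) (by fun_prop))

theorem GoodCoeff.locallyLipschitz_Ecoef (h : GoodCoeff lam0 M0 a) (h0 : 0 < lam0)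
    (hre : ∀ y, 0 < (zetafun a ξ γ τ s y).re) : LocallyLipschitz (Ecoef a ξ γ τ s α β) :=
  (LocallyLipschitz.fun_mul' (.const _) (h.locallyLipschitz_tC h0)).fun_sub'
    (locallyLipschitz_weight.fun_add' (h.locallyLipschitz_sqz h0 hre))

theorem GoodCoeff.locallyLipschitz_Fcoef (h : GoodCoeff lam0 M0 a) (h0 : 0 < lam0)
    (hre : ∀ y, 0 < (zetafun a ξ γ τ s y).re) : LocallyLipschitz (Fcoef a ξ γ τ s α β) :=
  (LocallyLipschitz.fun_mul' (.const _) (h.locallyLipschitz_tC h0)).fun_sub'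
    (locallyLipschitz_weight.fun_sub' (h.locallyLipschitz_sqz h0 hre))

theorem GoodCoeff.locallyLipschitz_omegaP (h : GoodCoeff lam0 M0 a) (h0 : 0 < lam0)
    (hre : ∀ y, 0 < (zetafun a ξ γ τ s y).re) {v : ℝ → ℂ} (hv : ContDiff ℝ (⊤ : ℕ∞) v) :
    LocallyLipschitz (omegaP a ξ γ τ s α β v) := by
  refine h.locallyLipschitz_ann.ofReal.fun_mul' (LocallyLipschitz.fun_add' ?_
    ((h.locallyLipschitz_Fcoef h0 hre).fun_mul' ?_))
  · exact ContDiff.locallyLipschitz (𝕂 := ℝ) ((contDiff_infty_iff_deriv.1 hv).2.of_le (by simp))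
  · exact ContDiff.locallyLipschitz (𝕂 := ℝ) (hv.of_le (by simp))

theorem hasCompactSupport_omegaP {v : ℝ → ℂ} (hv : HasCompactSupport v) :
    HasCompactSupport (omegaP a ξ γ τ s α β v) :=
  (hv.deriv.add (hv.mul_left (f := Fcoef a ξ γ τ s α β))).mul_left
    (f := fun y => (ann a y : ℂ))

theorem norm_le_Lam (ξ : Em m) (τ : ℝ) : ‖ξ‖ ≤ Lam ξ τ :=
  Real.le_sqrt_of_sq_le (by nlinarith [sq_nonneg τ])

theorem le_Lam (ξ : Em m) (τ : ℝ) : τ ≤ Lam ξ τ :=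
  Real.le_sqrt_of_sq_le (by nlinarith [sq_nonneg ‖ξ‖])

theorem Lam_le (hτ : 0 ≤ τ) : Lam ξ τ ≤ ‖ξ‖ + τ :=
  Real.sqrt_le_iff.2 ⟨by positivity, by nlinarith [mul_nonneg (norm_nonneg ξ) hτ]⟩

theorem GoodCoeff.norm_sqz_le (h : GoodCoeff lam0 M0 a) (hB : GoodB lam1 a) (h0 : 0 < lam0)
    (h0' : lam0 ≤ 1) (h1 : 0 < lam1) (h1' : lam1 ≤ 1) (hγ : ‖γ‖ ≤ 1) (hs : 0 ≤ s) (hs' : s ≤ 1)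
    (hτ : 0 ≤ τ) (y : ℝ) : ‖sqz a ξ γ τ s y‖ ≤ 2 * (lam0 * lam1)⁻¹ * Lam ξ τ := by
  have hΛ : 0 ≤ Lam ξ τ := Real.sqrt_nonneg _
  have hμ : 1 ≤ (lam0 * lam1)⁻¹ :=
    (one_le_inv₀ (by positivity)).2 (mul_le_one₀ h0' h1.le h1')
  refine le_of_sq_le_sq ?_ (by positivity)
  rw [← norm_pow, sqz, Complex.cpow_half_sq]
  refine (h.norm_zetafun_le hB h0 h1 ξ γ τ s y).trans ?_
  have e : ‖ξ‖ ^ 2 + (s * τ) ^ 2 * ‖γ‖ ^ 2 ≤ Lam ξ τ ^ 2 := by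
    rw [Lam, Real.sq_sqrt (by positivity)]
    have e1 : (s * τ) ^ 2 ≤ τ ^ 2 := by
      gcongr
      exact mul_le_of_le_one_left hτ hs'
    have e2 : ‖γ‖ ^ 2 ≤ 1 := pow_le_one₀ (norm_nonneg _) hγ
    nlinarith [mul_le_mul e1 e2 (by positivity) (by positivity)]
  calc 2 * (lam0 * lam1)⁻¹ * (‖ξ‖ ^ 2 + (s * τ) ^ 2 * ‖γ‖ ^ 2)
      ≤ 2 * (lam0 * lam1)⁻¹ * Lam ξ τ ^ 2 := by gcongr
    _ ≤ (2 * (lam0 * lam1)⁻¹) ^ 2 * Lam ξ τ ^ 2 := by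
        gcongr
        nlinarith
    _ = _ := by ring

/-- The lower constant in the ellipticity of `Ecoef`. -/
def lowerConst (lam0 lam1 α : ℝ) : ℝ := min (min (α / 4) (lam0 * lam1 / 2)) 1

/-- The upper constant in the bound of `Ecoef`. -/
def upperConst (lam0 lam1 α : ℝ) : ℝ := 2 * lam0⁻¹ ^ 2 + α + 1 + 2 * (lam0 * lam1)⁻¹

theorem lowerConst_pos (h0 : 0 < lam0) (h1 : 0 < lam1) (hα : 0 < α) :
    0 < lowerConst lam0 lam1 α := by
  unfold lowerConst
  positivity

theorem GoodCoeff.mul_abs_tform_le (h : GoodCoeff lam0 M0 a) (h0 : 0 < lam0) (hγ : ‖γ‖ ≤ 1)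
    (hs : 0 ≤ s) (y : ℝ) : s * |tform a γ y| ≤ s * lam0⁻¹ ^ 2 := by
  have := h.abs_tform_le h0 y γ
  gcongr
  exact this.trans (mul_le_of_le_one_right (by positivity) hγ)

theorem GoodCoeff.le_neg_Ecoef_re (h : GoodCoeff lam0 M0 a) (hB : GoodB lam1 a) (h0 : 0 < lam0)
    (h0' : lam0 ≤ 1) (h1 : 0 < lam1) (h1' : lam1 ≤ 1) (hγ : ‖γ‖ ≤ 1) (hs : 0 ≤ s)
    (hτ : 0 ≤ τ) (hsτ : s * τ ≤ lam1 / 2 * ‖ξ‖) (hsα : s * lam0⁻¹ ^ 2 ≤ α / 4)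
    {u y : ℝ} (hu : 0 ≤ u) (huy : α / 2 + u ≤ α + β * y) :
    lowerConst lam0 lam1 α * (Lam ξ τ + τ * u) ≤ -(Ecoef a ξ γ τ s α β y).re := by
  have hre : -(Ecoef a ξ γ τ s α β y).re =
      τ * (s * tform a γ y) + τ * (α + β * y) + (sqz a ξ γ τ s y).re := by
    simp [Ecoef, tC]
    ring
  have hsq : lam0 * lam1 / 2 * ‖ξ‖ ≤ (sqz a ξ γ τ s y).re := by
    refine Complex.le_cpow_half_re ((le_trans ?_) (h.le_zetafun_re hB h0 h1 hγ hs hτ hsτ y))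
    rw [mul_pow]
    have hμ : lam0 * lam1 ≤ 1 := mul_le_one₀ h0' h1.le h1'
    have : 0 < lam0 * lam1 := by positivity
    gcongr
    nlinarith
  have ht : -(α / 4) ≤ s * tform a γ y := by
    have e1 := h.mul_abs_tform_le h0 hγ hs y
    have e2 : s * -|tform a γ y| ≤ s * tform a γ y := by
      gcongr
      exact neg_abs_le _
    linarith
  have c1 : lowerConst lam0 lam1 α ≤ α / 4 := (min_le_left _ _).trans (min_le_left _ _)
  have c2 : lowerConst lam0 lam1 α ≤ lam0 * lam1 / 2 := (min_le_left _ _).trans (min_le_right _ _)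
  have c3 : lowerConst lam0 lam1 α ≤ 1 := min_le_right _ _
  have hα : 0 ≤ α := by
    have : 0 ≤ s * lam0⁻¹ ^ 2 := by positivity
    linarith
  have c0 : 0 ≤ lowerConst lam0 lam1 α := by
    unfold lowerConst
    positivity
  rw [hre]
  have k1 : τ * (α / 4 + u) ≤ τ * (s * tform a γ y + (α + β * y)) :=
    mul_le_mul_of_nonneg_left (by linarith) hτ
  calc lowerConst lam0 lam1 α * (Lam ξ τ + τ * u)
      ≤ lowerConst lam0 lam1 α * (‖ξ‖ + τ + τ * u) := by
        gcongr
        exact Lam_le hτ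
    _ = lowerConst lam0 lam1 α * ‖ξ‖ + lowerConst lam0 lam1 α * τ +
          lowerConst lam0 lam1 α * (τ * u) := by ring
    _ ≤ lam0 * lam1 / 2 * ‖ξ‖ + α / 4 * τ + 1 * (τ * u) := by gcongr
    _ ≤ _ := by linarith

theorem GoodCoeff.norm_Ecoef_le (h : GoodCoeff lam0 M0 a) (hB : GoodB lam1 a) (h0 : 0 < lam0)
    (h0' : lam0 ≤ 1) (h1 : 0 < lam1) (h1' : lam1 ≤ 1) (hγ : ‖γ‖ ≤ 1) (hs : 0 ≤ s) (hs' : s ≤ 1)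
    (hτ : 0 ≤ τ) (hα : 0 ≤ α) {u y : ℝ} (hu : 0 ≤ u) (huy0 : 0 ≤ α + β * y)
    (huy : α + β * y ≤ α + u) :
    ‖Ecoef a ξ γ τ s α β y‖ ≤ upperConst lam0 lam1 α * (Lam ξ τ + τ * u) := by
  have hΛ1 := norm_le_Lam ξ τ
  have hΛ2 := le_Lam ξ τ
  have hΛ : 0 ≤ Lam ξ τ := hτ.trans hΛ2
  have n1 : ‖tC a ξ γ τ s y‖ ≤ lam0⁻¹ ^ 2 * Lam ξ τ + lam0⁻¹ ^ 2 * Lam ξ τ := by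
    refine (norm_add_le _ _).trans (add_le_add ?_ ?_)
    · rw [Complex.norm_real, Real.norm_eq_abs]
      exact (h.abs_tform_le h0 y ξ).trans (by gcongr)
    · rw [norm_mul, norm_mul, Complex.norm_I, one_mul, Complex.norm_real, Complex.norm_real,
        Real.norm_of_nonneg (by positivity), Real.norm_eq_abs]
      calc τ * s * |tform a γ y| = τ * (s * |tform a γ y|) := by ring
        _ ≤ Lam ξ τ * (1 * lam0⁻¹ ^ 2) := by
          have := h.mul_abs_tform_le h0 hγ hs y
          have : s * lam0⁻¹ ^ 2 ≤ 1 * lam0⁻¹ ^ 2 := by gcongr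
          exact mul_le_mul hΛ2 (by linarith) (by positivity) hΛ
        _ = _ := by ring
  have n2 : ‖((τ * (α + β * y) : ℝ) : ℂ)‖ ≤ α * Lam ξ τ + τ * u := by
    rw [Complex.norm_real, Real.norm_of_nonneg (by positivity)]
    calc τ * (α + β * y) ≤ τ * (α + u) := by gcongr
      _ = α * τ + τ * u := by ring
      _ ≤ _ := by gcongr
  have n3 := h.norm_sqz_le (ξ := ξ) hB h0 h0' h1 h1' hγ hs hs' hτ y
  have n4 : ‖Ecoef a ξ γ τ s α β y‖ ≤ ‖tC a ξ γ τ s y‖ +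
      (‖((τ * (α + β * y) : ℝ) : ℂ)‖ + ‖sqz a ξ γ τ s y‖) := by
    refine (norm_sub_le _ _).trans (add_le_add ?_ (norm_add_le _ _))
    simp
  have hτu : 0 ≤ τ * u := by positivity
  have p1 : 0 ≤ (2 * lam0⁻¹ ^ 2 + α + 2 * (lam0 * lam1)⁻¹) * (τ * u) := by positivity
  unfold upperConst
  linarith

theorem GoodCoeff.mfun_le (h : GoodCoeff lam0 M0 a) (hB : GoodB lam1 a) (h0 : 0 < lam0)
    (h0' : lam0 ≤ 1) (h1 : 0 < lam1) (h1' : lam1 ≤ 1) (ξ : Em m) (y : ℝ) :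
    mfun a ξ y ≤ (lam0 * lam1)⁻¹ * ‖ξ‖ := by
  obtain ⟨hn1, -⟩ := h.ann_bounds y
  have hn : 0 < ann a y := h0.trans_le hn1
  have hμ : 1 ≤ (lam0 * lam1)⁻¹ :=
    (one_le_inv₀ (by positivity)).2 (mul_le_one₀ h0' h1.le h1')
  refine Real.sqrt_le_iff.2 ⟨by positivity, ?_⟩
  calc Bform a ξ ξ y / ann a y ≤ lam1⁻¹ * ‖ξ‖ ^ 2 / lam0 := by
        have := (hB ξ y).2
        gcongr
    _ = (lam0 * lam1)⁻¹ * ‖ξ‖ ^ 2 := by field_simp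
    _ ≤ (lam0 * lam1)⁻¹ ^ 2 * ‖ξ‖ ^ 2 := by
        gcongr
        nlinarith
    _ = _ := by ring

theorem half_le_one_sub_kappa (ap am : ℝ → Matrix (Fin (m + 1)) (Fin (m + 1)) ℝ) {αp αm : ℝ}
    (hp : 0 < αp) (hm : 0 < αm) : 1 / 2 ≤ 1 - kappa ap am αp αm := by
  have hL : 0 ≤ Lconst ap am :=
    Real.iSup_nonneg fun ξ => div_nonneg (Real.sqrt_nonneg _) (Real.sqrt_nonneg _)
  have : 0 ≤ Lconst ap am * (αm / αp) := by positivity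
  unfold kappa
  linarith

theorem GoodCoeff.le_mul_norm_of_le_mfun {ap am : ℝ → Matrix (Fin (m + 1)) (Fin (m + 1)) ℝ}
    (h : GoodCoeff lam0 M0 ap) (hB : GoodB lam1 ap) (h0 : 0 < lam0)
    (h0' : lam0 ≤ 1) (h1 : 0 < lam1) (h1' : lam1 ≤ 1) {αp αm : ℝ} (hp : 0 < αp) (hm : 0 < αm)
    (hτ : τ ≤ mfun ap ξ 0 / ((1 - kappa ap am αp αm) * αp)) :
    τ ≤ 2 / (lam0 * lam1 * αp) * ‖ξ‖ := by
  have hκ := half_le_one_sub_kappa ap am hp hm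
  have hm' := h.mfun_le hB h0 h0' h1 h1' ξ 0
  calc τ ≤ mfun ap ξ 0 / ((1 - kappa ap am αp αm) * αp) := hτ
    _ ≤ (lam0 * lam1)⁻¹ * ‖ξ‖ / (1 / 2 * αp) := by gcongr
    _ = _ := by field_simp

end Operators

section Estimates

variable {m : ℕ} {a : ℝ → Matrix (Fin (m + 1)) (Fin (m + 1)) ℝ} {lam0 M0 lam1 : ℝ}
  {ξ γ : Em m} {τ s α β : ℝ}

theorem GoodCoeff.zetafun_re_pos (h : GoodCoeff lam0 M0 a) (hB : GoodB lam1 a) (h0 : 0 < lam0)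
    (h1 : 0 < lam1) (hγ : ‖γ‖ ≤ 1) (hs : 0 ≤ s) (hτ : 0 ≤ τ)
    (hsτ : s * τ ≤ lam1 / 2 * ‖ξ‖) (hξ : 0 < ‖ξ‖) (y : ℝ) : 0 < (zetafun a ξ γ τ s y).re :=
  lt_of_lt_of_le (by positivity) (h.le_zetafun_re hB h0 h1 hγ hs hτ hsτ y)

theorem GoodCoeff.Eop_energy_le_L2p (h : GoodCoeff lam0 M0 a) (hB : GoodB lam1 a) (h0 : 0 < lam0)
    (h0' : lam0 ≤ 1) (h1 : 0 < lam1) (h1' : lam1 ≤ 1) (hα : 0 < α) (hβ : 0 < β) (hγ : ‖γ‖ ≤ 1)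
    (hs : 0 ≤ s) (hs' : s ≤ 1) (hτ : 0 < τ) (hξ : 0 < ‖ξ‖) (hsτ : s * τ ≤ lam1 / 2 * ‖ξ‖)
    (hsα : s * lam0⁻¹ ^ 2 ≤ α / 4) {f : ℝ → ℂ} (hf : LocallyLipschitz f)
    (hfs : HasCompactSupport f) :
    Lam ξ τ * ‖f 0‖ ^ 2 + Lam ξ τ ^ 2 * L2p f + L2p (deriv f) ≤
      energyConst (lowerConst lam0 lam1 α) (upperConst lam0 lam1 α) *
        L2p (Eop a ξ γ τ s α β f) := by
  have hre := h.zetafun_re_pos hB h0 h1 hγ hs hτ.le hsτ hξ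
  refine hf.energy_le_L2p (k := τ * β) hfs (h.locallyLipschitz_Ecoef h0 hre).continuous
    (hτ.trans_le (le_Lam ξ τ)) (by positivity) (lowerConst_pos h0 h1 hα) (fun y hy => ?_)
    (fun y hy => ?_)
  · rw [mul_assoc]
    exact h.le_neg_Ecoef_re hB h0 h0' h1 h1' hγ hs hτ.le hsτ hsα (by positivity) (by linarith)
  · rw [mul_assoc]
    exact h.norm_Ecoef_le hB h0 h0' h1 h1' hγ hs hs' hτ.le hα.le (by positivity) (by positivity)
      le_rfl

theorem GoodCoeff.Eop_energy_le_L2m (h : GoodCoeff lam0 M0 a) (hB : GoodB lam1 a) (h0 : 0 < lam0)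
    (h0' : lam0 ≤ 1) (h1 : 0 < lam1) (h1' : lam1 ≤ 1) (hα : 0 < α) (hβ : 0 < β) (hγ : ‖γ‖ ≤ 1)
    (hs : 0 ≤ s) (hs' : s ≤ 1) (hτ : 0 < τ) (hξ : 0 < ‖ξ‖) (hsτ : s * τ ≤ lam1 / 2 * ‖ξ‖)
    (hsα : s * lam0⁻¹ ^ 2 ≤ α / 4) {f : ℝ → ℂ} (hf : LocallyLipschitz f)
    (hfs : HasCompactSupport f) (hsupp : Function.support f ⊆ Set.Icc (-(α / (2 * β))) 0) :
    Lam ξ τ ^ 2 * L2m f + L2m (deriv f) ≤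
      energyConst (lowerConst lam0 lam1 α) (upperConst lam0 lam1 α) *
        L2m (Eop a ξ γ τ s α β f) +
      energyConst (lowerConst lam0 lam1 α) (upperConst lam0 lam1 α) * Lam ξ τ * ‖f 0‖ ^ 2 := by
  have hre := h.zetafun_re_pos hB h0 h1 hγ hs hτ.le hsτ hξ
  have hy2 : ∀ y, f y ≠ 0 → α / 2 ≤ α + β * y := fun y hfy => by
    have h2 : β * -(α / (2 * β)) ≤ β * y := by
      gcongr
      exact (hsupp hfy).1
    have h3 : β * -(α / (2 * β)) = -(α / 2) := by field_simp
    linarith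
  refine hf.energy_le_L2m hfs (h.locallyLipschitz_Ecoef h0 hre).continuous
    (hτ.trans_le (le_Lam ξ τ)) (lowerConst_pos h0 h1 hα) (fun y hy hfy => ?_)
    (fun y hy hfy => ?_)
  · have e := h.le_neg_Ecoef_re (ξ := ξ) (γ := γ) (τ := τ) (s := s) (α := α) (β := β) (u := 0)
      (y := y) hB h0 h0' h1 h1' hγ hs hτ.le hsτ hsα le_rfl (by linarith [hy2 y hfy])
    rwa [mul_zero, add_zero] at e
  · have hy0 : β * y ≤ 0 := mul_nonpos_of_nonneg_of_nonpos hβ.le hy.le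
    have e := h.norm_Ecoef_le (ξ := ξ) (γ := γ) (τ := τ) (s := s) (α := α) (β := β) (u := 0)
      (y := y) hB h0 h0' h1 h1' hγ hs hs' hτ.le hα.le le_rfl (by linarith [hy2 y hfy])
      (by linarith)
    rwa [mul_zero, add_zero] at e

end Estimates

/-- **Lemma 3.8.** In Case 3 (`τ ≤ m₊(ξ,0)/((1-κ)α₊)`), the estimates (3.120) and (3.121)
hold, with `C` depending only on `λ₀, M₀, α₊, α₋, β`. -/
theorem statement9 (m : ℕ) (hm : 1 ≤ m) (lam0 M0 lam1 : ℝ)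
    (hlam0 : 0 < lam0) (hlam0' : lam0 ≤ 1) (hM0 : 0 < M0)
    (hlam1 : 0 < lam1) (hlam1' : lam1 ≤ lam0) :
    ∀ αp αm β : ℝ, 0 < αp → 0 < αm → 0 < β →
    ∃ C > 0, ∀ ap am : ℝ → Matrix (Fin (m + 1)) (Fin (m + 1)) ℝ,
      GoodCoeff lam0 M0 ap → GoodCoeff lam0 M0 am →
      GoodB lam1 ap → GoodB lam1 am →
      Lconst ap am < αp / αm →
      ∀ (γ ξ : Em m), ‖γ‖ ≤ 1 →
      ∀ τ s s0 : ℝ, 1 ≤ τ → C ≤ τ → 0 < s → s ≤ s0 → s0 < 1 → s0 ≤ 1 / C →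
        τ ≤ mfun ap ξ 0 / ((1 - kappa ap am αp αm) * αp) →
      ∀ vp vm : ℝ → ℂ,
        ContDiff ℝ (⊤ : ℕ∞) vp → HasCompactSupport vp →
        ContDiff ℝ (⊤ : ℕ∞) vm → HasCompactSupport vm →
        (Lam ξ τ * ‖omegaP ap ξ γ τ s αp β vp 0‖ ^ 2 +
            (Lam ξ τ) ^ 2 * L2p (omegaP ap ξ γ τ s αp β vp) +
            L2p (deriv (omegaP ap ξ γ τ s αp β vp)) ≤
          C * L2p (Eop ap ξ γ τ s αp β (omegaP ap ξ γ τ s αp β vp))) ∧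
        (Function.support vm ⊆ Set.Icc (-(αm / (2 * β))) 0 →
          (Lam ξ τ) ^ 2 * L2m vm + L2m (deriv vm) ≤
            C * L2m (Eop am ξ γ τ s αm β vm) + C * Lam ξ τ * ‖vm 0‖ ^ 2) := by
  intro αp αm β hαp hαm hβ
  have hlam1'' : lam1 ≤ 1 := hlam1'.trans hlam0'
  set Cp := energyConst (lowerConst lam0 lam1 αp) (upperConst lam0 lam1 αp)
  set Cm := energyConst (lowerConst lam0 lam1 αm) (upperConst lam0 lam1 αm)
  have hCp : 0 < Cp := energyConst_pos (lowerConst_pos hlam0 hlam1 hαp)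
  have hCm : 0 < Cm := energyConst_pos (lowerConst_pos hlam0 hlam1 hαm)
  set Sp := 4 * lam0⁻¹ ^ 2 / αp with hSp
  set Sm := 4 * lam0⁻¹ ^ 2 / αm with hSm
  set K := 2 / (lam0 * lam1 * αp)
  have hK : 0 < K := by positivity
  set Sξ := 2 * K / lam1 with hSξ
  have hSp0 : 0 < Sp := by positivity
  have hSm0 : 0 < Sm := by positivity
  have hSξ0 : 0 < Sξ := by positivity
  refine ⟨Cp + Cm + Sp + Sm + Sξ, by positivity, ?_⟩
  intro ap am hap ham hBp hBm _ γ ξ hγ τ s s0 hτ1 _ hs hss0 hs01 hs0C hτ vp vm hvp hvps hvm hvms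
  set C := Cp + Cm + Sp + Sm + Sξ with hC
  have hC0 : 0 < C := by positivity
  have hs1 : s ≤ 1 := hss0.trans hs01.le
  have hτ0 : 0 < τ := one_pos.trans_le hτ1
  have hsC : s * C ≤ 1 := (le_div_iff₀ hC0).1 (hss0.trans hs0C)
  have hle : ∀ {X : ℝ}, X ≤ C → s * X ≤ 1 := fun hX =>
    (mul_le_mul_of_nonneg_left hX hs.le).trans hsC
  have hτK : τ ≤ K * ‖ξ‖ :=
    hap.le_mul_norm_of_le_mfun hBp hlam0 hlam0' hlam1 hlam1'' hαp hαm hτ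
  have hξ : 0 < ‖ξ‖ := pos_of_mul_pos_right (hτ0.trans_le hτK) hK.le
  have hsp : s * lam0⁻¹ ^ 2 ≤ αp / 4 := by
    have e := hle (X := Sp) (by linarith)
    have : s * lam0⁻¹ ^ 2 = s * Sp * (αp / 4) := by
      rw [hSp]
      field_simp
    rw [this]
    exact mul_le_of_le_one_left (by positivity) e
  have hsm : s * lam0⁻¹ ^ 2 ≤ αm / 4 := by
    have e := hle (X := Sm) (by linarith)
    have : s * lam0⁻¹ ^ 2 = s * Sm * (αm / 4) := by
      rw [hSm]
      field_simp
    rw [this]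
    exact mul_le_of_le_one_left (by positivity) e
  have hsτ : s * τ ≤ lam1 / 2 * ‖ξ‖ := by
    have e := hle (X := Sξ) (by linarith)
    calc s * τ ≤ s * (K * ‖ξ‖) := by gcongr
      _ = s * Sξ * (lam1 / 2 * ‖ξ‖) := by
        rw [hSξ]
        field_simp
      _ ≤ _ := mul_le_of_le_one_left (by positivity) e
  refine ⟨?_, fun hsupp => ?_⟩
  · have hre := hap.zetafun_re_pos hBp hlam0 hlam1 hγ hs.le hτ0.le hsτ hξ
    refine (hap.Eop_energy_le_L2p hBp hlam0 hlam0' hlam1 hlam1'' hαp hβ hγ hs.le hs1 hτ0 hξ hsτ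
      hsp (hap.locallyLipschitz_omegaP hlam0 hre hvp) (hasCompactSupport_omegaP hvps)).trans ?_
    exact mul_le_mul_of_nonneg_right (by linarith) (L2p_nonneg _)
  · refine (ham.Eop_energy_le_L2m hBm hlam0 hlam0' hlam1 hlam1'' hαm hβ hγ hs.le hs1 hτ0 hξ hsτ
      hsm (ContDiff.locallyLipschitz (𝕂 := ℝ) (hvm.of_le (by simp))) hvms hsupp).trans ?_
    have hΛ : 0 ≤ Lam ξ τ := Real.sqrt_nonneg _
    have := L2m_nonneg (Eop am ξ γ τ s αm β vm)
    have hCmC : Cm ≤ C := by linarith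
    gcongr
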